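/- arXiv:2509.19935 — 2 statements merged into one kernel-verified Lean document; each statement's English description precedes it below -/
import Mathlib

section
/- Let n be a positive integer, let 0 < x ≤ b, and set β = ⌈nb⌉/n. Then exp(−1/(2nβ))/√(2πnβ) · exp(−n·H(β,x)) ≤ P(N_{nx} ≥ nb). -/
open Real

/-- Poisson probability mass function with mean `lam`: `P(N_lam = k)`. -/
noncomputable def poissonProb (lam : ℝ) (k : ℕ) : ℝ := lam ^ k * Real.exp (-lam) / k.factorial

/-- Kullback–Leibler divergence between Poisson random variables with means `t` and `x`. -/
noncomputable def H (t x : ℝ) : ℝ := t * Real.log (t / x) - t + x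

/-- The Robbins upper bound for the Stirling sequence. -/
theorem log_stirlingSeq_le {k : ℕ} (hk : k ≠ 0) :
    Real.log (Stirling.stirlingSeq k) ≤ Real.log (√π) + 1 / (12 * k) := by
  have hmono : Monotone fun n : ℕ ↦
      Real.log (Stirling.stirlingSeq (n + 1)) - 1 / (12 * ((n : ℝ) + 1)) := by
    refine monotone_nat_of_le_succ fun n ↦ ?_
    have h := Stirling.log_stirlingSeq_sdiff_le (n + 1)
    have e : (1 : ℝ) / (12 * ((n : ℝ) + 1) * ((n : ℝ) + 1 + 1)) =
        1 / (12 * ((n : ℝ) + 1)) - 1 / (12 * ((n : ℝ) + 1 + 1)) := by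
      field_simp
      ring
    push_cast at h ⊢
    linarith
  have hlim : Filter.Tendsto (fun n : ℕ ↦
      Real.log (Stirling.stirlingSeq (n + 1)) - 1 / (12 * ((n : ℝ) + 1))) Filter.atTop
      (nhds (Real.log (√π) - 1 / 12 * 0)) := by
    refine Filter.Tendsto.sub ?_ ?_
    · exact (Stirling.tendsto_stirlingSeq_sqrt_pi.comp (Filter.tendsto_add_atTop_nat 1)).log
        (by positivity)
    · refine (tendsto_one_div_add_atTop_nhds_zero_nat.const_mul (1 / 12 : ℝ)).congr fun n ↦ ?_
      field_simp
  obtain ⟨m, rfl⟩ := Nat.exists_eq_succ_of_ne_zero hk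
  have h := hmono.ge_of_tendsto hlim m
  simp only [Nat.succ_eq_add_one, Nat.cast_add, Nat.cast_one] at h ⊢
  linarith

/-- The Stirling upper bound for the factorial, with the Robbins error term. -/
theorem factorial_le_stirling {k : ℕ} (hk : k ≠ 0) :
    (k.factorial : ℝ) ≤ √(2 * π * k) * (k / Real.exp 1) ^ k * Real.exp (1 / (12 * k)) := by
  have hk' : (0 : ℝ) < k := by positivity
  have hs : 0 < Stirling.stirlingSeq k := by
    unfold Stirling.stirlingSeq
    positivity
  have h : Stirling.stirlingSeq k ≤ √π * Real.exp (1 / (12 * k)) := by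
    rw [← Real.log_le_log_iff hs (by positivity), Real.log_mul (by positivity) (by positivity),
      Real.log_exp]
    exact log_stirlingSeq_le hk
  rw [Stirling.stirlingSeq, div_le_iff₀ (by positivity)] at h
  have e : √(2 * π * k) = √π * √(2 * k) := by
    rw [← Real.sqrt_mul (by positivity)]
    ring_nf
  rw [e]
  linarith

theorem summable_poissonProb (lam : ℝ) : Summable (poissonProb lam) := by
  refine ((Real.summable_pow_div_factorial lam).mul_right (Real.exp (-lam))).congr fun k ↦ ?_
  unfold poissonProb
  ring

theorem poissonProb_nonneg {lam : ℝ} (h : 0 ≤ lam) (k : ℕ) : 0 ≤ poissonProb lam k := by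
  unfold poissonProb
  positivity

/-- A Poisson point probability is at most the probability of any right tail containing it. -/
theorem poissonProb_le_tail {lam a : ℝ} (h : 0 ≤ lam) {k : ℕ} (hk : a ≤ k) :
    poissonProb lam k ≤ ∑' j : ℕ, if a ≤ j then poissonProb lam j else 0 := by
  have hnonneg (j : ℕ) : 0 ≤ if a ≤ j then poissonProb lam j else 0 := by
    split_ifs
    exacts [poissonProb_nonneg h j, le_rfl]
  have hsum : Summable fun j : ℕ ↦ if a ≤ j then poissonProb lam j else 0 := by
    refine Summable.of_nonneg_of_le hnonneg (fun j ↦ ?_) (summable_poissonProb lam)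
    split_ifs
    exacts [le_rfl, poissonProb_nonneg h j]
  simpa [hk] using hsum.le_tsum k fun j _ ↦ hnonneg j

theorem exp_neg_H {k : ℕ} (hk : k ≠ 0) {lam : ℝ} (h : 0 < lam) :
    Real.exp (-H k lam) = lam ^ k * Real.exp (-lam) / (k / Real.exp 1) ^ k := by
  have hk' : (0 : ℝ) < k := by positivity
  rw [← Real.exp_log (show 0 < lam ^ k * Real.exp (-lam) / (k / Real.exp 1) ^ k by positivity),
    Real.log_div (by positivity) (by positivity), Real.log_mul (by positivity) (by positivity),
    Real.log_pow, Real.log_pow, Real.log_exp, Real.log_div (by positivity) (by positivity),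
    Real.log_exp, H, Real.log_div (by positivity) (by positivity)]
  ring_nf

/-- The Poisson point probabilities are bounded below through the divergence `H`. -/
theorem le_poissonProb {k : ℕ} (hk : k ≠ 0) {lam : ℝ} (h : 0 < lam) :
    Real.exp (-1 / (12 * k)) / √(2 * π * k) * Real.exp (-H k lam) ≤ poissonProb lam k := by
  have hk' : (0 : ℝ) < k := by positivity
  rw [exp_neg_H hk h, poissonProb, neg_div, Real.exp_neg (1 / (12 * (k : ℝ)))]
  calc _ = lam ^ k * Real.exp (-lam) /
        (√(2 * π * k) * (k / Real.exp 1) ^ k * Real.exp (1 / (12 * k))) := by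
        field_simp
    _ ≤ _ := by
        gcongr
        exact factorial_le_stirling hk

theorem mul_H_mul_mul {n : ℝ} (hn : n ≠ 0) (t x : ℝ) : n * H t x = H (n * t) (n * x) := by
  rw [H, H, mul_div_mul_left _ _ hn]
  ring

theorem poisson_right_tail_lower (n : ℕ) (hn : 0 < n) (x b : ℝ) (hx : 0 < x) (hxb : x ≤ b)
    (β : ℝ) (hβ : β = (⌈(n : ℝ) * b⌉ : ℝ) / n) :
    Real.exp (-1 / (2 * n * β)) / Real.sqrt (2 * π * n * β) * Real.exp (-(n : ℝ) * H β x) ≤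
      ∑' k : ℕ, if (n : ℝ) * b ≤ k then poissonProb ((n : ℝ) * x) k else 0 := by
  have hn' : (0 : ℝ) < n := by positivity
  have hb : 0 < (n : ℝ) * b := mul_pos hn' (hx.trans_le hxb)
  obtain ⟨k, hk⟩ := Int.eq_ofNat_of_zero_le (Int.ceil_pos.2 hb).le
  have hle : (n : ℝ) * b ≤ k := by
    have := Int.le_ceil ((n : ℝ) * b)
    rw [hk] at this
    exact_mod_cast this
  have hkpos : (0 : ℝ) < k := hb.trans_le hle
  have hk0 : k ≠ 0 := by exact_mod_cast hkpos.ne'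
  have hnβ : (n : ℝ) * β = k := by
    rw [hβ, hk, mul_div_cancel₀ _ hn'.ne', Int.cast_natCast]
  have hlam : 0 < (n : ℝ) * x := mul_pos hn' hx
  refine le_trans ?_ (poissonProb_le_tail hlam.le hle)
  refine le_trans ?_ (le_poissonProb hk0 hlam)
  rw [neg_mul, mul_H_mul_mul hn'.ne', mul_assoc 2, mul_assoc (2 * π), hnβ, neg_div, neg_div]
  gcongr
  norm_num
end

section
/- Let n be a positive integer and let 1/n ≤ a < x, and set α = ⌊na⌋/n. Suppose f, ℓ : [0,∞) → ℝ are functions such that ℓ is affine, f(t) = ℓ(t) for all t ∈ (a,∞), and ‖f − ℓ‖ := sup_{t ≥ 0}|f(t) − ℓ(t)| < ∞. Then |S_n f(x) − f(x)| ≤ ‖f − ℓ‖·L_n(x,α)·exp(−n·H(α,x)). -/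
open Real

/-- The Szász–Mirakyan operator: `S_n f x = E f(N_{nx}/n)`. -/
noncomputable def szasz (n : ℕ) (f : ℝ → ℝ) (x : ℝ) : ℝ :=
  ∑' k : ℕ, f ((k : ℝ) / n) * poissonProb ((n : ℝ) * x) k

/-- `L_n(x,α)` from the left-tail bound. -/
noncomputable def Ln (n : ℕ) (x α : ℝ) : ℝ :=
  min (x / ((x - α + 1 / n) * Real.sqrt (2 * π * n * α))) (1 / 2) + 1 / Real.sqrt (2 * π * n * α)

open Finset in
/-- The Poisson weights left of the mode, compared with the weight at the cut-off. -/
lemma sum_range_pow_div_factorial_mul_le {lam : ℝ} (hlam : 0 ≤ lam) (m : ℕ) :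
    (∑ k ∈ range m, lam ^ k / k.factorial) * (lam - m + 1) ≤ m * (lam ^ m / m.factorial) := by
  induction m with
  | zero => simp
  | succ m ih =>
    have hS : 0 ≤ ∑ k ∈ range m, lam ^ k / k.factorial :=
      sum_nonneg fun k _ => by positivity
    have ht : ((m + 1 : ℕ) : ℝ) * (lam ^ (m + 1) / (m + 1).factorial)
        = lam * (lam ^ m / m.factorial) := by
      have := Nat.factorial_ne_zero m
      rw [Nat.factorial_succ]
      push_cast
      field_simp
      ring
    rw [ht, sum_range_succ]
    push_cast
    nlinarith

/-- For integer mean `m`, Poisson weights at reflected positions are ordered. -/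
lemma pow_div_factorial_le_reflect (m j : ℕ) : ∀ i : ℕ, i + j + 1 = m →
    (m : ℝ) ^ i / i.factorial ≤ (m : ℝ) ^ (m + j) / (m + j).factorial := by
  induction j with
  | zero =>
    intro i hi
    subst hi
    have := Nat.factorial_ne_zero i
    simp only [add_zero, Nat.factorial_succ]
    push_cast
    apply le_of_eq
    field_simp
    ring
  | succ j ih =>
    intro i hi
    have h := ih (i + 1) (by omega)
    have hm : (0 : ℝ) < m := by exact_mod_cast (by omega : 0 < m)
    have hi' : (m : ℝ) = i + (j + 1) + 1 := by exact_mod_cast hi.symm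
    have h₁ : (m : ℝ) ^ i / i.factorial
        = (m : ℝ) ^ (i + 1) / (i + 1).factorial * ((i + 1) / m) := by
      have := Nat.factorial_ne_zero i
      rw [Nat.factorial_succ]
      push_cast
      field_simp
      ring
    have h₂ : (m : ℝ) ^ (m + (j + 1)) / (m + (j + 1)).factorial
        = (m : ℝ) ^ (m + j) / (m + j).factorial * (m / (m + j + 1)) := by
      have := Nat.factorial_ne_zero (m + j)
      rw [← add_assoc, Nat.factorial_succ]
      push_cast
      field_simp
      ring
    rw [h₁, h₂]
    refine mul_le_mul h ?_ (by positivity) (by positivity)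
    rw [div_le_div_iff₀ hm (by positivity)]
    nlinarith [sq_nonneg ((j : ℝ) + 1)]

open Finset in
/-- A Poisson variable of integer mean `m` is smaller than `m` with probability at most `1/2`. -/
lemma two_mul_sum_range_pow_div_factorial_le_exp (m : ℕ) :
    2 * ∑ k ∈ range m, (m : ℝ) ^ k / k.factorial ≤ exp m := by
  have h₁ : ∑ k ∈ range m, (m : ℝ) ^ k / k.factorial
      ≤ ∑ j ∈ range m, (m : ℝ) ^ (m + j) / (m + j).factorial := by
    rw [← sum_range_reflect]
    refine sum_le_sum fun j hj => pow_div_factorial_le_reflect m j _ ?_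
    have := mem_range.1 hj
    omega
  have h₂ := Real.sum_le_exp_of_nonneg (Nat.cast_nonneg (α := ℝ) m) (m + m)
  rw [sum_range_add] at h₂
  linarith

open Finset in
lemma sum_range_pow_div_factorial_le_half {lam : ℝ} {m : ℕ} (hm : 0 < m) (hlam : m ≤ lam) :
    ∑ k ∈ range m, lam ^ k / k.factorial ≤ 1 / 2 * ((lam / m) ^ m * exp m) := by
  have hm' : (0 : ℝ) < m := by exact_mod_cast hm
  have hl : 0 < lam := hm'.trans_le hlam
  have h : ∑ k ∈ range m, lam ^ k / k.factorial
      ≤ (lam / m) ^ m * ∑ k ∈ range m, (m : ℝ) ^ k / k.factorial := by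
    rw [mul_sum]
    refine sum_le_sum fun k hk => ?_
    have h₁ : lam ^ k / k.factorial = (lam / m) ^ k * ((m : ℝ) ^ k / k.factorial) := by
      rw [div_pow]
      field_simp
    rw [h₁]
    refine mul_le_mul_of_nonneg_right ?_ (by positivity)
    exact pow_le_pow_right₀ ((one_le_div hm').2 hlam) (mem_range.1 hk).le
  have h₂ := mul_le_mul_of_nonneg_left (two_mul_sum_range_pow_div_factorial_le_exp m)
    (by positivity : 0 ≤ (lam / m) ^ m)
  linarith

lemma pow_div_factorial_le_stirling {lam : ℝ} (hlam : 0 ≤ lam) {m : ℕ} (hm : 0 < m) :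
    lam ^ m / m.factorial ≤ 1 / √(2 * π * m) * ((lam / m) ^ m * exp m) := by
  have hm' : (0 : ℝ) < m := by exact_mod_cast hm
  have hpi := Real.pi_pos
  have h := Stirling.le_factorial_stirling m
  have hs : 0 < √(2 * π * m) := by positivity
  have he : exp m = exp 1 ^ m := by rw [← Real.exp_nat_mul, mul_one]
  calc lam ^ m / m.factorial ≤ lam ^ m / (√(2 * π * m) * (m / exp 1) ^ m) := by gcongr
    _ = _ := by
      rw [he, div_pow, div_pow]
      field_simp

open Finset in
/-- Left-tail bound for the Poisson distribution at an integer below its mean. -/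
lemma sum_range_poissonProb_le {lam : ℝ} {m : ℕ} (hm : 0 < m) (hlam : m ≤ lam) :
    ∑ k ∈ range (m + 1), poissonProb lam k ≤
      (min (lam / ((lam - m + 1) * √(2 * π * m))) (1 / 2) + 1 / √(2 * π * m)) *
        ((lam / m) ^ m * exp m * exp (-lam)) := by
  have hm' : (0 : ℝ) < m := by exact_mod_cast hm
  have hl : 0 < lam := hm'.trans_le hlam
  have hpi := Real.pi_pos
  have hs : 0 < √(2 * π * m) := by positivity
  have hd : 0 < lam - m + 1 := by linarith
  have hsum : ∑ k ∈ range (m + 1), poissonProb lam k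
      = (∑ k ∈ range (m + 1), lam ^ k / k.factorial) * exp (-lam) := by
    rw [sum_mul]
    exact sum_congr rfl fun k _ => by rw [poissonProb]; ring
  have hst := pow_div_factorial_le_stirling hl.le hm
  set E := (lam / m) ^ m * exp m with hE
  have hEpos : 0 < E := by positivity
  rw [hsum, ← mul_assoc, sum_range_succ]
  refine mul_le_mul_of_nonneg_right ?_ (exp_pos _).le
  rw [add_mul]
  refine add_le_add ?_ hst
  rw [min_mul_of_nonneg _ _ hEpos.le]
  refine le_min ?_ (sum_range_pow_div_factorial_le_half hm hlam)
  have h := sum_range_pow_div_factorial_mul_le hl.le m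
  calc _ ≤ m * (lam ^ m / m.factorial) / (lam - m + 1) := (le_div_iff₀ hd).2 h
    _ ≤ lam * (1 / √(2 * π * m) * E) / (lam - m + 1) := by gcongr
    _ = _ := by field_simp

lemma hasSum_poissonProb (lam : ℝ) : HasSum (poissonProb lam) 1 := by
  have h := (NormedSpace.expSeries_div_hasSum_exp lam).mul_right (exp (-lam))
  rw [← Real.exp_eq_exp_ℝ, ← Real.exp_add, add_neg_cancel, Real.exp_zero] at h
  have he : poissonProb lam = fun k : ℕ => lam ^ k / k.factorial * exp (-lam) := by
    funext k
    rw [poissonProb]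
    ring
  rwa [he]

lemma hasSum_natCast_mul_poissonProb (lam : ℝ) :
    HasSum (fun k : ℕ => (k : ℝ) * poissonProb lam k) lam := by
  rw [← hasSum_nat_add_iff' 1]
  have h := (hasSum_poissonProb lam).mul_left lam
  simp only [Finset.range_one, Finset.sum_singleton, Nat.cast_zero, zero_mul, sub_zero]
  rw [mul_one] at h
  have he : (fun k : ℕ => ((k + 1 : ℕ) : ℝ) * poissonProb lam (k + 1))
      = fun k => lam * poissonProb lam k := by
    funext k
    have := Nat.factorial_ne_zero k
    rw [poissonProb, poissonProb, Nat.factorial_succ]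
    push_cast
    field_simp
    ring
  rwa [he]

lemma hasSum_affine_mul_poissonProb {n : ℕ} (hn : 0 < n) (x c d : ℝ) :
    HasSum (fun k : ℕ => (c * ((k : ℝ) / n) + d) * poissonProb (n * x) k) (c * x + d) := by
  have hn' : (n : ℝ) ≠ 0 := by exact_mod_cast hn.ne'
  have h := ((hasSum_natCast_mul_poissonProb (n * x)).mul_left (c / n)).add
    ((hasSum_poissonProb (n * x)).mul_left d)
  have hsum : c / n * (n * x) + d * 1 = c * x + d := by field_simp
  have hterm : (fun k : ℕ => (c * ((k : ℝ) / n) + d) * poissonProb (n * x) k)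
      = fun k : ℕ => c / n * (k * poissonProb (n * x) k) + d * poissonProb (n * x) k := by
    funext k
    ring
  rwa [hterm, ← hsum]

lemma exp_neg_mul_H {n m : ℕ} (hn : 0 < n) (hm : 0 < m) {x : ℝ} (hx : 0 < x) :
    exp (-(n : ℝ) * H (m / n) x) = (n * x / m) ^ m * exp m * exp (-(n * x)) := by
  have hn' : (0 : ℝ) < n := by exact_mod_cast hn
  have hm' : (0 : ℝ) < m := by exact_mod_cast hm
  have hlog : log ((m : ℝ) / n / x) = -log (n * x / m) := by
    rw [← Real.log_inv]
    congr 1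
    field_simp
  rw [H, hlog, ← Real.exp_log (by positivity : 0 < (n * x / m) ^ m), ← Real.exp_add,
    ← Real.exp_add, Real.log_pow]
  congr 1
  field_simp
  ring

theorem szasz_locally_affine_rate_sup_right_infinite (n : ℕ) (hn : 0 < n) (a x : ℝ)
    (ha : 1 / n ≤ a) (hax : a < x)
    (α : ℝ) (hα : α = (⌊(n : ℝ) * a⌋ : ℝ) / n)
    (f ℓ : ℝ → ℝ) (hℓ : ∃ c d : ℝ, ∀ t : ℝ, 0 ≤ t → ℓ t = c * t + d)
    (hfℓ : ∀ t : ℝ, a < t → f t = ℓ t)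
    (M : ℝ) (hM : ∀ t : ℝ, 0 ≤ t → |f t - ℓ t| ≤ M) :
    |szasz n f x - f x| ≤ M * Ln n x α * Real.exp (-(n : ℝ) * H α x) := by
  obtain ⟨c, d, hcd⟩ := hℓ
  have hn' : (0 : ℝ) < n := by exact_mod_cast hn
  have ha0 : 0 < a := lt_of_lt_of_le (by positivity) ha
  have hx : 0 < x := ha0.trans hax
  have hna : (1 : ℝ) ≤ n * a := by
    rw [div_le_iff₀ hn'] at ha
    linarith
  have hM0 : 0 ≤ M := (abs_nonneg _).trans (hM 0 le_rfl)
  set m := ⌊(n : ℝ) * a⌋₊ with hm_def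
  have hm : 0 < m := Nat.floor_pos.2 hna
  have hm' : (0 : ℝ) < m := by exact_mod_cast hm
  have hmle : (m : ℝ) ≤ n * x :=
    (Nat.floor_le (by positivity)).trans (by gcongr)
  have hαm : α = (m : ℝ) / n := by
    rw [hα, hm_def, natCast_floor_eq_intCast_floor (by positivity)]
  have hp : ∀ k, 0 ≤ poissonProb (n * x) k := fun k => by
    unfold poissonProb; positivity
  have hzero : ∀ k ∉ Finset.range (m + 1),
      (f ((k : ℝ) / n) - ℓ ((k : ℝ) / n)) * poissonProb (n * x) k = 0 := by
    intro k hk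
    have hk' : m < k := by simpa [Nat.lt_succ_iff] using hk
    have : a < (k : ℝ) / n := by
      rw [lt_div_iff₀ hn', mul_comm]
      exact (Nat.floor_lt (by positivity)).1 hk'
    rw [hfℓ _ this, sub_self, zero_mul]
  have hsz : szasz n f x - f x = ∑ k ∈ Finset.range (m + 1),
      (f ((k : ℝ) / n) - ℓ ((k : ℝ) / n)) * poissonProb (n * x) k := by
    have h := (hasSum_affine_mul_poissonProb hn x c d).add (hasSum_sum_of_ne_finset_zero hzero)
    rw [hfℓ x hax, hcd x hx.le, sub_eq_iff_eq_add', szasz, ← h.tsum_eq]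
    refine tsum_congr fun k => ?_
    rw [hcd _ (by positivity)]
    ring
  have hLn : Ln n x α = min (n * x / ((n * x - m + 1) * √(2 * π * m))) (1 / 2)
      + 1 / √(2 * π * m) := by
    have h₁ : 2 * π * n * α = 2 * π * m := by
      rw [hαm]
      field_simp
    have h₂ : (n : ℝ) * x - m + 1 = n * (x - α + 1 / n) := by
      rw [hαm]
      field_simp
    rw [Ln, h₁, h₂, mul_assoc (n : ℝ), mul_div_mul_left _ _ hn'.ne']
  calc |szasz n f x - f x|
      ≤ ∑ k ∈ Finset.range (m + 1),
        |(f ((k : ℝ) / n) - ℓ ((k : ℝ) / n)) * poissonProb (n * x) k| := by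
        rw [hsz]
        exact Finset.abs_sum_le_sum_abs _ _
    _ ≤ ∑ k ∈ Finset.range (m + 1), M * poissonProb (n * x) k := by
        refine Finset.sum_le_sum fun k _ => ?_
        rw [abs_mul, abs_of_nonneg (hp k)]
        exact mul_le_mul_of_nonneg_right (hM _ (by positivity)) (hp k)
    _ = M * ∑ k ∈ Finset.range (m + 1), poissonProb (n * x) k := by rw [Finset.mul_sum]
    _ ≤ M * (Ln n x α * exp (-(n : ℝ) * H α x)) := by
        rw [hLn, hαm, exp_neg_mul_H hn hm hx]
        exact mul_le_mul_of_nonneg_left (sum_range_poissonProb_le hm hmle) hM0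
    _ = _ := by ring
end
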